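/- arXiv:2602.19726 — 6 statements merged into one kernel-verified Lean document; each statement's English description precedes it below -/
import Mathlib

section
/- Let f(x) = (x^k + c)^m − a x^n ∈ ℤ[x] be irreducible over ℚ. Then the discriminant of f satisfies 𝔇_f = (−1)^{C(km,2) + (km+n+t)(m−1)} · a^{k(m−1)} · c^{m(n−1)} · ( (km)^{k₁m} c^{k₁m−n₁} − a^{k₁} n^{n₁} (km−n)^{k₁m−n₁} )^{t}, where C(km,2) denotes the binomial coefficient 'km choose 2'. -/
open Polynomial

/-- The Sylvester matrix of two integer polynomials `P` and `Q`. -/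
noncomputable def sylv (P Q : Polynomial ℤ) :
    Matrix (Fin (Q.natDegree + P.natDegree)) (Fin (Q.natDegree + P.natDegree)) ℤ :=
  Matrix.of fun i j =>
    if (i : ℕ) < Q.natDegree then
      (if (j : ℕ) ≤ (i : ℕ) + P.natDegree then P.coeff (P.natDegree + (i : ℕ) - (j : ℕ)) else 0)
    else
      (if (j : ℕ) ≤ ((i : ℕ) - Q.natDegree) + Q.natDegree then
        Q.coeff (Q.natDegree + ((i : ℕ) - Q.natDegree) - (j : ℕ)) else 0)

/-- The resultant of two integer polynomials, as the determinant of the Sylvester matrix. -/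
noncomputable def resZ (P Q : Polynomial ℤ) : ℤ := (sylv P Q).det

/-- The discriminant of an integer polynomial:
`disc P = (-1)^(d(d-1)/2) * Res(P, P') / leadingCoeff P`. -/
noncomputable def discZ (P : Polynomial ℤ) : ℤ :=
  ((-1) ^ (P.natDegree * (P.natDegree - 1) / 2) * resZ P (Polynomial.derivative P)) /
    P.leadingCoeff

/-- The integer Sylvester determinant agrees with Mathlib's resultant. -/
lemma resZ_eq_resultant (P Q : ℤ[X]) : resZ P Q = P.resultant Q := by
  let e : Fin (P.natDegree + Q.natDegree) ≃ Fin (Q.natDegree + P.natDegree) :=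
    Fin.revPerm.trans (finCongr (add_comm _ _))
  have he (i) : (e i : ℕ) = P.natDegree + Q.natDegree - (i + 1) := by simp [e]
  rw [resZ, resultant, ← Matrix.det_submatrix_equiv_self e, ← Matrix.det_transpose]
  congr 1
  ext i j
  have hi := i.isLt
  induction j using Fin.addCases with
  | left j =>
    have hj := j.isLt
    simp only [Matrix.transpose_apply, Matrix.submatrix_apply, sylv, sylvester, Matrix.of_apply,
      Fin.addCases_left, he, Fin.val_castAdd, Set.mem_Icc]
    rw [if_neg (by omega)]
    by_cases h1 : (j : ℕ) ≤ i
    · rw [if_pos (by omega)]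
      by_cases h2 : (i : ℕ) ≤ j + Q.natDegree
      · rw [if_pos ⟨h1, h2⟩]
        congr 1
        omega
      · rw [if_neg (by omega)]
        exact coeff_eq_zero_of_natDegree_lt (by omega)
    · rw [if_neg (by omega), if_neg (by omega)]
  | right j =>
    have hj := j.isLt
    simp only [Matrix.transpose_apply, Matrix.submatrix_apply, sylv, sylvester, Matrix.of_apply,
      Fin.addCases_right, he, Fin.val_natAdd, Set.mem_Icc]
    rw [if_pos (by omega)]
    by_cases h1 : (j : ℕ) ≤ i
    · rw [if_pos (by omega)]
      by_cases h2 : (i : ℕ) ≤ j + P.natDegree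
      · rw [if_pos ⟨h1, h2⟩]
        congr 1
        omega
      · rw [if_neg (by omega)]
        exact coeff_eq_zero_of_natDegree_lt (by omega)
    · rw [if_neg (by omega), if_neg (by omega)]

lemma IsPrimitiveRoot.prod_range_sub_pow_mul {K : Type*} [Field K] {η : K} {r : ℕ}
    (hη : IsPrimitiveRoot η r) (hr : 0 < r) (s y : K) :
    ∏ i ∈ Finset.range r, (s - η ^ i * y) = s ^ r - y ^ r := by
  have h := congrArg (eval s) (X_pow_sub_C_eq_prod hη hr (rfl : y ^ r = y ^ r))
  simpa [eval_prod] using h.symm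

lemma IsPrimitiveRoot.prod_range_mul_sub_pow_mul {K : Type*} [Field K] {η : K} {r : ℕ}
    (hη : IsPrimitiveRoot η r) (hr : 0 < r) (s y : K) (t : ℕ) :
    ∏ i ∈ Finset.range (r * t), (s - η ^ i * y) = (s ^ r - y ^ r) ^ t := by
  induction t with
  | zero => simp
  | succ t ih =>
    rw [mul_add_one, Finset.prod_range_add, ih, pow_succ, ← hη.prod_range_sub_pow_mul hr s y]
    simp [pow_add, pow_mul, hη.pow_eq_one]

lemma IsPrimitiveRoot.prod_range_sub_mul_pow {K : Type*} [Field K] {ζ : K} {k₁ n₁ t : ℕ}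
    (hζ : IsPrimitiveRoot ζ (k₁ * t)) (hk : 0 < k₁ * t) (hcop : n₁.Coprime k₁) (s a γ : K) :
    ∏ i ∈ Finset.range (k₁ * t), (s - a * (ζ ^ i * γ) ^ (n₁ * t)) =
      (s ^ k₁ - a ^ k₁ * (γ ^ (k₁ * t)) ^ n₁) ^ t := by
  have hη : IsPrimitiveRoot (ζ ^ (n₁ * t)) k₁ := by
    rw [mul_comm n₁, pow_mul]
    exact (hζ.pow hk (mul_comm _ _)).pow_of_coprime _ hcop
  have h := hη.prod_range_mul_sub_pow_mul (Nat.pos_of_mul_pos_right hk) s (a * γ ^ (n₁ * t)) t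
  rw [mul_pow, ← pow_mul] at h
  rw [← pow_mul, show k₁ * t * n₁ = n₁ * t * k₁ by ring, ← h]
  refine Finset.prod_congr rfl fun i _ ↦ ?_
  ring

section

variable {R : Type*} [CommRing R]

lemma natDegree_X_pow_add_C_pow_sub_le (a c : R) {k m n : ℕ} (hlt : n ≤ k * m) :
    ((X ^ k + C c) ^ m - C a * X ^ n : R[X]).natDegree ≤ k * m := by
  refine (natDegree_sub_le _ _).trans (max_le ?_ ((natDegree_C_mul_X_pow_le _ _).trans hlt))
  refine natDegree_pow_le.trans ?_
  rw [mul_comm]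
  gcongr
  exact natDegree_add_le_of_degree_le (natDegree_X_pow_le _) (by simp)

lemma monic_X_pow_add_C_pow_sub [Nontrivial R] (a c : R) {k m n : ℕ} (hlt : n < k * m) :
    ((X ^ k + C c) ^ m - C a * X ^ n : R[X]).Monic ∧
      ((X ^ k + C c) ^ m - C a * X ^ n : R[X]).natDegree = k * m := by
  have hk : k ≠ 0 := by rintro rfl; simp at hlt
  have hh : (X ^ k + C c : R[X]).Monic := monic_X_pow_add_C c hk
  have hd : ((X ^ k + C c : R[X]) ^ m).natDegree = k * m := by
    rw [hh.natDegree_pow, natDegree_X_pow_add_C, mul_comm]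
  have hdeg : (C a * X ^ n : R[X]).natDegree < ((X ^ k + C c : R[X]) ^ m).natDegree :=
    hd ▸ (natDegree_C_mul_X_pow_le a n).trans_lt hlt
  refine ⟨(hh.pow m).sub_of_left ?_, by rw [natDegree_sub_eq_left_of_natDegree_lt hdeg, hd]⟩
  exact degree_lt_degree hdeg

end

lemma resultant_C_mul_X_pow_sub_C_complex (a b c e : ℂ) (hb : b ≠ 0) {k₁ n₁ t m : ℕ}
    (hlt : n₁ * t < k₁ * t * m) (hcop : n₁.Coprime k₁) :
    (C b * X ^ (k₁ * t) - C e : ℂ[X]).resultant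
        ((X ^ (k₁ * t) + C c) ^ m - C a * X ^ (n₁ * t)) (k₁ * t) (k₁ * t * m) =
      ((e + b * c) ^ (k₁ * m) - a ^ k₁ * e ^ n₁ * b ^ (k₁ * m - n₁)) ^ t := by
  have hk : 0 < k₁ * t := by
    by_contra h
    simp [Nat.eq_zero_of_not_pos h] at hlt
  have hle : n₁ ≤ k₁ * m := by
    refine le_of_mul_le_mul_right (?_ : n₁ * t ≤ _ * t) (Nat.pos_of_mul_pos_left hk)
    linarith [mul_right_comm k₁ t m]
  obtain ⟨ζ, hζ⟩ : ∃ ζ : ℂ, IsPrimitiveRoot ζ (k₁ * t) :=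
    ⟨_, Complex.isPrimitiveRoot_exp _ hk.ne'⟩
  obtain ⟨γ, hγ⟩ := IsAlgClosed.exists_pow_nat_eq (e / b) hk
  set f : ℂ[X] := (X ^ (k₁ * t) + C c) ^ m - C a * X ^ (n₁ * t) with hf
  have hu : (C b * X ^ (k₁ * t) - C e : ℂ[X]) =
      C b * ∏ i ∈ Finset.range (k₁ * t), (X - C (ζ ^ i * γ)) := by
    rw [← X_pow_sub_C_eq_prod hζ hk hγ, mul_sub, ← C_mul, mul_div_cancel₀ _ hb]
  have hfd : f.natDegree ≤ k₁ * t * m := natDegree_X_pow_add_C_pow_sub_le a c hlt.le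
  have hprod := resultant_prod_left (Finset.range (k₁ * t)) (fun i ↦ X - C (ζ ^ i * γ)) f
    (k₁ * t * m) (by simp only [leadingCoeff_X_sub_C, Finset.prod_const_one, ne_eq,
      one_ne_zero, not_false_eq_true]) hfd
  have hnd : (∏ i ∈ Finset.range (k₁ * t), (X - C (ζ ^ i * γ))).natDegree = k₁ * t := by
    rw [natDegree_prod_of_monic _ _ fun i _ ↦ monic_X_sub_C _]
    simp only [natDegree_X_sub_C, Finset.sum_const, Finset.card_range, smul_eq_mul, mul_one]
  have heval (i : ℕ) : f.eval (ζ ^ i * γ) =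
      ((e + b * c) / b) ^ m - a * (ζ ^ i * γ) ^ (n₁ * t) := by
    have : (ζ ^ i * γ) ^ (k₁ * t) = e / b := by
      rw [mul_pow, hγ, ← pow_mul, mul_comm i, pow_mul, hζ.pow_eq_one, one_pow, one_mul]
    simp only [hf, eval_sub, eval_pow, eval_add, eval_X, eval_C, eval_mul, this]
    congr 2
    field_simp
  rw [hnd] at hprod
  rw [hu, resultant_C_mul_left, hprod]
  simp only [natDegree_X_sub_C, resultant_X_sub_C_left _ _ _ hfd, heval]
  rw [hζ.prod_range_sub_mul_pow hk hcop, hγ, show k₁ * t * m = k₁ * m * t by ring, pow_mul,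
    ← mul_pow]
  congr 1
  obtain ⟨q, hq⟩ := Nat.exists_eq_add_of_le hle
  rw [mul_sub, ← pow_mul, mul_comm m, div_pow, mul_div_cancel₀ _ (pow_ne_zero _ hb), hq,
    Nat.add_sub_cancel_left, pow_add b, div_pow]
  field_simp

/-- The resultant of `b x^k - e` with `(x^k + c)^m - a x^n`. -/
lemma resultant_C_mul_X_pow_sub_C (a b c e : ℤ) (hb : b ≠ 0) {k₁ n₁ t m : ℕ}
    (hlt : n₁ * t < k₁ * t * m) (hcop : n₁.Coprime k₁) :
    (C b * X ^ (k₁ * t) - C e : ℤ[X]).resultant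
        ((X ^ (k₁ * t) + C c) ^ m - C a * X ^ (n₁ * t)) (k₁ * t) (k₁ * t * m) =
      ((e + b * c) ^ (k₁ * m) - a ^ k₁ * e ^ n₁ * b ^ (k₁ * m - n₁)) ^ t := by
  apply RingHom.injective_int (Int.castRingHom ℂ)
  have hu : (C b * X ^ (k₁ * t) - C e : ℤ[X]).map (Int.castRingHom ℂ) =
      C (b : ℂ) * X ^ (k₁ * t) - C (e : ℂ) := by simp
  have hf : ((X ^ (k₁ * t) + C c) ^ m - C a * X ^ (n₁ * t) : ℤ[X]).map (Int.castRingHom ℂ) =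
      (X ^ (k₁ * t) + C (c : ℂ)) ^ m - C (a : ℂ) * X ^ (n₁ * t) := by simp
  rw [← resultant_map_map, hu, hf,
    resultant_C_mul_X_pow_sub_C_complex a b c e (Int.cast_ne_zero.mpr hb) hlt hcop]
  simp

/-- The resultant of `x^k + c` with `(x^k + c)^m - a x^n`. -/
lemma resultant_X_pow_add_C {R : Type*} [CommRing R] [Nontrivial R] (a c : R) {k m n : ℕ}
    (hlt : n < k * m) :
    (X ^ k + C c : R[X]).resultant ((X ^ k + C c) ^ m - C a * X ^ n) k (k * m) =
      (-a) ^ k * ((-1) ^ (k * n) * c ^ n) := by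
  have hk : k ≠ 0 := by rintro rfl; simp at hlt
  obtain ⟨m, rfl⟩ : ∃ m', m = m' + 1 := Nat.exists_eq_succ_of_ne_zero (by rintro rfl; simp at hlt)
  have hd : (X ^ k + C c : R[X]).natDegree = k := natDegree_X_pow_add_C
  have hpow : ((X ^ k + C c : R[X]) ^ m).natDegree + k ≤ k * (m + 1) := by
    rw [(monic_X_pow_add_C c hk).natDegree_pow, hd]
    linarith
  rw [show ((X ^ k + C c) ^ (m + 1) - C a * X ^ n : R[X]) =
      C (-a) * X ^ n + (X ^ k + C c) * (X ^ k + C c) ^ m by rw [C_neg]; ring,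
    resultant_add_mul_right _ _ _ _ _ hpow hd.le, resultant_C_mul_right,
    ← Nat.add_sub_of_le hlt.le, resultant_add_right_deg _ _ _ _ _ (natDegree_X_pow_le n),
    resultant_X_pow_right _ _ _ hd.le]
  simp [coeff_X_pow, coeff_C, hk, hk.symm]

lemma even_resultant_sign_exponent {k m n t : ℕ} (ht : t = n.gcd k) :
    Even (k * (m + 1) + k * (m + 1) * k + (k * (m + 1) * k + k + k * n) * m +
      (k * (m + 1) + n + t) * m) := by
  have h2 : Even t ↔ Even n ∧ Even k := by
    rw [ht, even_iff_two_dvd, even_iff_two_dvd, even_iff_two_dvd, Nat.dvd_gcd_iff]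
  by_cases hk : Even k <;> by_cases hm : Even m <;> by_cases hn : Even n <;>
    simp [Nat.even_add, Nat.even_mul, h2, hk, hm, hn]

/-- The resultant of `(x^k + c)^m - a x^n` with its derivative, up to the factor `c^m`. -/
lemma resultant_derivative_mul (a c : ℤ) {k₁ n₁ t m : ℕ} (hn : 1 ≤ n₁ * t)
    (hlt : n₁ * t < k₁ * t * (m + 1)) (hcop : n₁.Coprime k₁) (f : ℤ[X])
    (hf : f = (X ^ (k₁ * t) + C c) ^ (m + 1) - C a * X ^ (n₁ * t)) :
    (-1) ^ (k₁ * t * (m + 1)) * c ^ (m + 1) * f.resultant (derivative f) =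
      ((-1) ^ (k₁ * t * (m + 1) * (k₁ * t)) *
        ((-a) ^ (k₁ * t) * ((-1) ^ (k₁ * t * (n₁ * t)) * c ^ (n₁ * t)))) ^ m *
      ((-1) ^ (k₁ * t * (m + 1) * (k₁ * t)) *
        ((((n₁ * t : ℕ) : ℤ) * c + (((k₁ * t * (m + 1) : ℕ) : ℤ) - (n₁ * t : ℕ)) * c) ^
            (k₁ * (m + 1)) -
          a ^ k₁ * (((n₁ * t : ℕ) : ℤ) * c) ^ n₁ *
            (((k₁ * t * (m + 1) : ℕ) : ℤ) - (n₁ * t : ℕ)) ^ (k₁ * (m + 1) - n₁)) ^ t) := by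
  have hb : ((k₁ * t * (m + 1) : ℕ) : ℤ) - (n₁ * t : ℕ) ≠ 0 := by omega
  have hres := resultant_C_mul_X_pow_sub_C a _ c ((n₁ * t : ℕ) * c) hb hlt hcop
  have hresh := resultant_X_pow_add_C a c hlt
  have hdeg := (monic_X_pow_add_C_pow_sub a c hlt).2
  rw [← hf] at hres hresh hdeg
  generalize hn' : n₁ * t = n at *
  generalize hk' : k₁ * t = k at *
  have hk : k ≠ 0 := by rintro rfl; simp at hlt
  set b : ℤ := ((k * (m + 1) : ℕ) : ℤ) - n with hbdef
  set u : ℤ[X] := C b * X ^ k - C (n * c) with hu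
  have hudeg : u.natDegree = k := by
    rw [hu, natDegree_sub_C, natDegree_C_mul_X_pow _ _ hb]
  have hhdeg : (X ^ k + C c : ℤ[X]).natDegree = k := natDegree_X_pow_add_C
  have hkey : X * derivative f = (X ^ k + C c) ^ m * u + f * C (n : ℤ) := by
    obtain ⟨k, rfl⟩ := Nat.exists_eq_succ_of_ne_zero hk
    obtain ⟨n, rfl⟩ := Nat.exists_eq_succ_of_ne_zero (Nat.one_le_iff_ne_zero.mp hn)
    rw [hu, hbdef, hf]
    simp only [derivative_sub, derivative_pow, derivative_add, derivative_C,
      derivative_mul, derivative_X, Nat.add_sub_cancel, Nat.succ_eq_add_one, C_mul, C_sub]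
    push_cast
    simp only [map_natCast, map_add, map_mul, map_one]
    ring
  have hderiv : (derivative f).natDegree = k * (m + 1) - 1 := by
    rw [natDegree_derivative, hdeg]
  have hX := resultant_mul_right f X (derivative f) (k * (m + 1)) hdeg.le
  have hright := resultant_mul_right f ((X ^ k + C c) ^ m) u (k * (m + 1)) hdeg.le
  have hpow := resultant_pow_right f (X ^ k + C c) (k * (m + 1)) m hdeg.le
    (by rw [(monic_X_pow_add_C c hk).leadingCoeff, one_pow]; exact one_ne_zero)
  have hpowdeg : ((X ^ k + C c : ℤ[X]) ^ m).natDegree = m * k := by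
    rw [(monic_X_pow_add_C c hk).natDegree_pow, hhdeg]
  have hfX : f.resultant X (k * (m + 1)) (X : ℤ[X]).natDegree =
      (-1) ^ (k * (m + 1)) * c ^ (m + 1) := by
    rw [natDegree_X]
    have h0 : f.coeff 0 = c ^ (m + 1) := by
      rw [coeff_zero_eq_eval_zero, hf]
      simp [hk, (Nat.one_le_iff_ne_zero.mp hn)]
    have := resultant_X_sub_C_right f (k * (m + 1)) 0 hdeg.le
    rwa [C_0, sub_zero, ← coeff_zero_eq_eval_zero, h0] at this
  rw [hfX, natDegree_X, hderiv, Nat.add_sub_cancel' (by omega), hkey,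
    resultant_add_mul_right _ _ _ _ _ (by simp) hdeg.le] at hX
  rw [hpow, hpowdeg, hudeg, hhdeg, show m * k + k = k * (m + 1) by ring] at hright
  rw [hdeg, hderiv, ← hX, hright, resultant_comm f, resultant_comm f u, hres, hresh]

/-- The discriminant of `f(x) = (x^k + c)^m - a x^n`. -/
theorem statement_0 (a c : ℤ) (hc : c ≠ 0) (k m n : ℕ) (hn : 1 ≤ n) (hlt : n < k * m)
    (t n1 k1 : ℕ) (ht : t = Nat.gcd n k) (hn1 : n = n1 * t) (hk1 : k = k1 * t)
    (hirr : Irreducible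
      (((X ^ k + C c) ^ m - C a * X ^ n : Polynomial ℤ).map (Int.castRingHom ℚ))) :
    discZ ((X ^ k + C c) ^ m - C a * X ^ n) =
      (-1) ^ ((k * m).choose 2 + (k * m + n + t) * (m - 1)) *
        a ^ (k * (m - 1)) * c ^ (m * (n - 1)) *
        (((k * m : ℕ) : ℤ) ^ (k1 * m) * c ^ (k1 * m - n1) -
          a ^ k1 * (n : ℤ) ^ n1 * (((k * m : ℕ) : ℤ) - (n : ℤ)) ^ (k1 * m - n1)) ^ t := by
  have htpos : 0 < t := ht ▸ Nat.gcd_pos_of_pos_left k hn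
  have hcop : n1.Coprime k1 := by
    have h := Nat.gcd_mul_right n1 t k1
    rw [← hn1, ← hk1, ← ht] at h
    exact Nat.eq_of_mul_eq_mul_right htpos (by rw [one_mul]; exact h.symm)
  obtain ⟨m, rfl⟩ : ∃ m', m = m' + 1 := Nat.exists_eq_succ_of_ne_zero (by rintro rfl; simp at hlt)
  have hle : n1 ≤ k1 * (m + 1) := by
    refine le_of_mul_le_mul_right (?_ : n1 * t ≤ _ * t) htpos
    rw [← hn1, mul_right_comm, ← hk1]
    exact hlt.le
  obtain ⟨hmon, hdeg⟩ := monic_X_pow_add_C_pow_sub a c hlt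
  have hres := resultant_derivative_mul a c (hn1 ▸ hn) (hn1 ▸ hk1 ▸ hlt) hcop _ rfl
  rw [← hn1, ← hk1, hdeg] at hres
  rw [discZ, resZ_eq_resultant, hmon.leadingCoeff, hdeg, Int.ediv_one, Nat.add_sub_cancel,
    ← Nat.choose_two_right, pow_add _ (Nat.choose _ _), mul_assoc, mul_assoc, mul_assoc]
  congr 1
  generalize resultant (R := ℤ) _ _ _ _ = r at hres ⊢
  have hsum : (n : ℤ) * c + (((k * (m + 1) : ℕ) : ℤ) - n) * c = (k * (m + 1) : ℕ) * c := by ring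
  have hcn : c ^ n = (c ^ n1) ^ t := by rw [← pow_mul, ← hn1]
  rw [hsum] at hres
  generalize hD : ((k * (m + 1) : ℕ) : ℤ) = D at *
  obtain ⟨q, hq⟩ := Nat.exists_eq_add_of_le hle
  rw [hq, Nat.add_sub_cancel_left] at hres ⊢
  have hfactor : (D * c) ^ (n1 + q) - a ^ k1 * (n * c) ^ n1 * (D - n) ^ q =
      c ^ n1 * (D ^ (n1 + q) * c ^ q - a ^ k1 * n ^ n1 * (D - n) ^ q) := by
    ring
  rw [hfactor, mul_pow (c ^ n1), ← hcn] at hres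
  generalize (D ^ (n1 + q) * c ^ q - a ^ k1 * (n : ℤ) ^ n1 * (D - n) ^ q) ^ t = Δ at hres ⊢
  obtain ⟨n, rfl⟩ : ∃ n', n = n' + 1 := Nat.exists_eq_succ_of_ne_zero (by omega)
  rw [Nat.add_sub_cancel]
  have hsign : (-1 : ℤ) ^ (k * (m + 1) * k + (k * (m + 1) * k + k + k * (n + 1)) * m) =
      (-1) ^ (k * (m + 1) + (k * (m + 1) + (n + 1) + t) * m) := by
    refine neg_one_pow_congr ?_
    have h := even_resultant_sign_exponent (m := m) ht
    grind
  refine mul_left_cancel₀ (mul_ne_zero (pow_ne_zero (k * (m + 1)) (by norm_num : (-1 : ℤ) ≠ 0))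
    (pow_ne_zero (m + 1) hc)) (hres.trans ?_)
  calc
    _ = (-1 : ℤ) ^ (k * (m + 1) * k + (k * (m + 1) * k + k + k * (n + 1)) * m) *
        (a ^ (k * m) * c ^ ((n + 1) * (m + 1)) * Δ) := by
      rw [neg_pow a]
      generalize k * (m + 1) * k = j
      ring
    _ = _ := by
      rw [hsign]
      generalize k * (m + 1) = j
      ring
end

section
/- Let p be a prime, let κ ≥ 1 be the highest power of p dividing n, write n = p^κ s′, and let c be an integer not divisible by p. Suppose x^{s′} − c̄ factors over ℤ/pℤ as ḡ₁(x)⋯ḡ_r(x), a product of distinct irreducible polynomials, with each g_i(x) ∈ ℤ[x] monic. Then there exist polynomials H₁(x), H₂(x), H₃(x) ∈ ℤ[x] such that x^n − c = (g₁(x)⋯g_r(x) + pH₁(x))^{p^κ} + p·g₁(x)⋯g_r(x)·H₂(x) + p²H₃(x) + c^{p^κ} − c. -/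
open Polynomial

/-- Binomial-expansion lemma: if `p^κ ∥ n` with `n = p^κ s'`, `p ∤ c`,
and `x^(s') - c` factors modulo `p` as a product of distinct monic irreducibles
`g₁ ⋯ g_r`, then `x^n - c` admits the stated decomposition. -/
theorem statement_6 (p : ℕ) (hp : p.Prime) (κ : ℕ) (hκ : 1 ≤ κ) (n s' : ℕ)
    (hn : n = p ^ κ * s') (hs' : ¬ p ∣ s') (c : ℤ) (hc : ¬ (p : ℤ) ∣ c)
    (r : ℕ) (G : Fin r → Polynomial ℤ)
    (hmonic : ∀ i, (G i).Monic)
    (hirr : ∀ i, Irreducible ((G i).map (Int.castRingHom (ZMod p))))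
    (hdist : Function.Injective fun i => (G i).map (Int.castRingHom (ZMod p)))
    (hfact : (Polynomial.X ^ s' - Polynomial.C c).map (Int.castRingHom (ZMod p)) =
      ∏ i, (G i).map (Int.castRingHom (ZMod p))) :
    ∃ H1 H2 H3 : Polynomial ℤ,
      Polynomial.X ^ n - Polynomial.C c =
        ((∏ i, G i) + Polynomial.C (p : ℤ) * H1) ^ p ^ κ +
          Polynomial.C (p : ℤ) * (∏ i, G i) * H2 +
          Polynomial.C (p : ℤ) ^ 2 * H3 + Polynomial.C (c ^ p ^ κ - c) := by
  have hdvd : C (p : ℤ) ∣ X ^ s' - C c - ∏ i, G i := by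
    rw [C_dvd_iff_dvd_coeff]
    intro k
    have hk := congrArg (fun f => f.coeff k) hfact
    rw [← Polynomial.map_prod] at hk
    simp only [coeff_map] at hk
    rw [coeff_sub, ← CharP.intCast_eq_zero_iff (ZMod p) p,
      ← eq_intCast (Int.castRingHom (ZMod p)), map_sub, hk, sub_self]
  obtain ⟨H, hH⟩ := hdvd
  obtain ⟨K, hK⟩ := exists_add_pow_prime_pow_eq hp (X ^ s' - C c : ℤ[X]) (C c) κ
  refine ⟨H, C c * K, H * (C c * K), ?_⟩
  have hF : X ^ s' - C c = (∏ i, G i) + C (p : ℤ) * H := by rw [← hH]; ring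
  have hp' : (p : ℤ[X]) = C (p : ℤ) := by simp
  rw [sub_add_cancel, ← pow_mul, mul_comm s', ← hn, hF, hp'] at hK
  rw [hK, C_sub, C_pow]
  ring
end

section
/- Let f(x) = (x^k + c)^m − a x^n ∈ ℤ[x] be of degree km, and let p be a prime such that n = p^j s and k = p^j s′ with j ≥ 1 and p ∤ gcd(s, s′). Define h(x) = (x^{s′} + c)^m − a x^s ∈ ℤ[x] and t(x) = (1/p)( Σ_{i=0}^{p^j −1} C(p^j, i) x^{s′ i} c^{p^j − i} − c ) ∈ ℤ[x]. Then there exist polynomials h₁(x), h₄(x) ∈ ℤ[x] such that f(x) = h(x)^{p^j} + (a^{p^j} − a) x^n − p·m·t(x)·(x^k + c)^{m−1} + p·h(x)·h₁(x) + p²·h₄(x). -/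
open Polynomial

/-- Decomposition of `f(x) = (x^k+c)^m - a x^n` when `n = p^j s`,
`k = p^j s'` with `p ∤ gcd(s,s')`:  with `h(x) = (x^(s')+c)^m - a x^s` and
`t(x) = (1/p)(∑_{i<p^j} C(p^j,i) x^(s'i) c^(p^j-i) - c)`, there are `h₁, h₄ ∈ ℤ[x]` with
`f = h^(p^j) + (a^(p^j)-a) x^n - p m t(x) (x^k+c)^(m-1) + p h h₁ + p² h₄`. -/
theorem statement_7 (a c : ℤ) (k m n : ℕ) (hn : 1 ≤ n) (hlt : n < k * m)
    (p : ℕ) (hp : p.Prime) (j s s' : ℕ) (hj : 1 ≤ j)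
    (hk : k = p ^ j * s') (hnn : n = p ^ j * s) (hss : ¬ p ∣ Nat.gcd s s')
    (tp : Polynomial ℤ)
    (htp : Polynomial.C (p : ℤ) * tp =
      (∑ i ∈ Finset.range (p ^ j),
        Polynomial.C (((p ^ j).choose i : ℤ) * c ^ (p ^ j - i)) * Polynomial.X ^ (s' * i)) -
        Polynomial.C c) :
    ∃ h1 h4 : Polynomial ℤ,
      ((X ^ k + C c) ^ m - C a * X ^ n : Polynomial ℤ) =
        ((X ^ s' + C c) ^ m - C a * X ^ s) ^ p ^ j +
          C (a ^ p ^ j - a) * X ^ n -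
          C (p : ℤ) * C (m : ℤ) * tp * (X ^ k + C c) ^ (m - 1) +
          C (p : ℤ) * ((X ^ s' + C c) ^ m - C a * X ^ s) * h1 +
          C (p : ℤ) ^ 2 * h4 := by
  subst hk hnn
  set h : ℤ[X] := (X ^ s' + C c) ^ m - C a * X ^ s
  set w : ℤ[X] := X ^ (p ^ j * s') + C c with hw
  have hu : (X ^ s' + C c : ℤ[X]) ^ p ^ j = w + C (p : ℤ) * tp := by
    rw [htp, add_pow, Finset.sum_range_succ, hw]
    have hsum : ∀ i ∈ Finset.range (p ^ j),
        (X ^ s' : ℤ[X]) ^ i * C c ^ (p ^ j - i) * ((p ^ j).choose i : ℤ[X]) =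
          C (((p ^ j).choose i : ℤ) * c ^ (p ^ j - i)) * X ^ (s' * i) := by
      intro i _
      simp only [map_mul, map_pow, map_natCast, pow_mul]
      ring
    rw [Finset.sum_congr rfl hsum]
    simp only [Nat.choose_self, Nat.sub_self, pow_zero, Nat.cast_one, mul_one, ← pow_mul,
      mul_comm s' (p ^ j)]
    ring
  obtain ⟨e, he⟩ := Polynomial.powAddExpansion w (C (p : ℤ) * tp) m
  obtain ⟨r, hr⟩ := exists_add_pow_prime_pow_eq hp h (C a * X ^ s) j
  have hum : h + C a * X ^ s = (X ^ s' + C c) ^ m := sub_add_cancel _ _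
  rw [hum, pow_right_comm, hu, he, mul_pow (C a), ← pow_mul X, mul_comm s] at hr
  refine ⟨C a * X ^ s * r, -(e * tp ^ 2), ?_⟩
  simp only [map_sub, map_pow, map_natCast] at hr ⊢
  linear_combination hr
end

section
/- Let f(x) = (x^k + c)^m − a x^n, let u₁, u₂ ∈ ℤ satisfy k u₁ + n u₂ = t, and let p be a prime such that p ∣ (𝒞 − ℰ) and p ∤ a·c·k·m·(km−n). Let α₁, α₂ ∈ ℤ satisfy α₁(km−n) ≡ nc (mod p²) and a·α₂·(km−n)^m ≡ (kmc)^m (mod p²), and let α ∈ ℤ satisfy α ≡ α₁^{u₁} α₂^{u₂} (mod p²). Then (α^{k₁} + c)^m − a·α^{n₁} ≡ 0 (mod p²) if and only if α₁^{n₁} ≡ α₂^{k₁} (mod p²). -/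
open Polynomial

/-- Integer powers in a commutative ring with zero-inverse: for `z < 0` we use
`Ring.inverse` of the positive power. -/
noncomputable def zpowR {R : Type*} [CommRing R] (x : R) (z : ℤ) : R :=
  if 0 ≤ z then x ^ z.toNat else Ring.inverse (x ^ (-z).toNat)

theorem zpowR_coe_units {R : Type*} [CommRing R] (x : Rˣ) (z : ℤ) :
    zpowR (x : R) z = ((x ^ z : Rˣ) : R) := by
  unfold zpowR
  split_ifs with h
  · lift z to ℕ using h
    simp
  · obtain ⟨w, rfl⟩ : ∃ w : ℕ, z = -(w : ℤ) := ⟨(-z).toNat, by omega⟩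
    rw [neg_neg, Int.toNat_natCast, zpow_neg, zpow_natCast, ← Units.val_pow_eq_pow_val,
      Ring.inverse_unit]

theorem one_add_pow_of_mul_self_eq_zero {R : Type*} [CommRing R] {w : R} (hw : w * w = 0)
    (m : ℕ) : (1 + w) ^ m = 1 + m * w := by
  induction m with
  | zero => simp
  | succ m ih =>
    rw [pow_succ, ih]
    push_cast
    linear_combination (m : R) * hw

theorem Units.val_zpow_of_eq_one_add {R : Type*} [CommRing R] {e : Rˣ} {w : R}
    (he : (e : R) = 1 + w) (hw : w * w = 0) (z : ℤ) : ((e ^ z : Rˣ) : R) = 1 + z * w := by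
  obtain ⟨j, rfl | rfl⟩ := z.eq_nat_or_neg
  · rw [zpow_natCast, Units.val_pow_eq_pow_val, he, one_add_pow_of_mul_self_eq_zero hw]
    simp
  · rw [zpow_neg, zpow_natCast, ← Units.mul_right_inj (e ^ j), Units.mul_inv,
      Units.val_pow_eq_pow_val, he, one_add_pow_of_mul_self_eq_zero hw]
    push_cast
    linear_combination (j : R) * j * hw

/-- If `y ^ k₁ = x ^ n₁ * (1 + w)` with `w² = 0`, then `x ^ u₁ * y ^ u₂` is a zero of
`(X ^ k₁ + c) ^ m - a * X ^ n₁` exactly when `w = 0`. -/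
theorem trinomial_eq_zero_iff {R : Type*} [CommRing R] {a c w : R} {x y s N t : Rˣ}
    {k m n k1 n1 : ℕ} {u1 u2 : ℤ} (hu1 : (k1 : ℤ) * u1 + (n1 : ℤ) * u2 = 1)
    (hu : (k : R) * u1 + (n : R) * u2 = t) (hN : (N : R) = k * m)
    (hs : (x : R) + c = s) (hx : (x : R) * N = s * n) (hy : a * y = s ^ m)
    (hw : w * w = 0) (hyx : (y : R) ^ k1 = x ^ n1 * (1 + w)) :
    (((x ^ u1 * y ^ u2 : Rˣ) : R) ^ k1 + c) ^ m - a * ((x ^ u1 * y ^ u2 : Rˣ) : R) ^ n1 = 0 ↔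
      w = 0 := by
  obtain ⟨e, he⟩ : ∃ e : Rˣ, y ^ k1 = x ^ n1 * e := ⟨(x ^ n1)⁻¹ * y ^ k1, by group⟩
  have hew : (e : R) = 1 + w := by
    rw [← Units.mul_right_inj (x ^ n1)]
    rw [Units.val_pow_eq_pow_val, ← hyx]
    exact_mod_cast (congrArg Units.val he).symm
  have hk : (x ^ u1 * y ^ u2) ^ k1 = x * e ^ u2 := by
    calc (x ^ u1 * y ^ u2) ^ k1 = x ^ ((k1 : ℤ) * u1) * (y ^ k1) ^ u2 := by
          rw [mul_pow, zpow_mul, zpow_natCast, ← zpow_natCast, ← zpow_natCast, ← zpow_natCast,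
            ← zpow_natCast, ← zpow_mul, ← zpow_mul, ← zpow_mul, ← zpow_mul, mul_comm u1,
            mul_comm u2]
      _ = x ^ ((k1 : ℤ) * u1 + (n1 : ℤ) * u2) * e ^ u2 := by
          rw [he, mul_zpow, zpow_add, zpow_mul x n1, zpow_natCast, mul_assoc]
      _ = x * e ^ u2 := by rw [hu1, zpow_one]
  have hn : (x ^ u1 * y ^ u2) ^ n1 = y * e ^ (-u1) := by
    have hx' : x ^ n1 = y ^ k1 * e⁻¹ := by rw [he, mul_inv_cancel_right]
    calc (x ^ u1 * y ^ u2) ^ n1 = (x ^ n1) ^ u1 * y ^ ((n1 : ℤ) * u2) := by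
          rw [mul_pow, zpow_mul, zpow_natCast, ← zpow_natCast, ← zpow_natCast, ← zpow_natCast,
            ← zpow_natCast, ← zpow_mul, ← zpow_mul, ← zpow_mul, ← zpow_mul, mul_comm u1,
            mul_comm u2]
      _ = y ^ ((k1 : ℤ) * u1 + (n1 : ℤ) * u2) * e ^ (-u1) := by
          rw [hx', mul_zpow, zpow_add, zpow_mul y k1, zpow_natCast, inv_zpow', mul_right_comm]
      _ = y * e ^ (-u1) := by rw [hu1, zpow_one]
  rw [← Units.val_pow_eq_pow_val, ← Units.val_pow_eq_pow_val, hk, hn, Units.val_mul,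
    Units.val_mul, Units.val_zpow_of_eq_one_add hew hw, Units.val_zpow_of_eq_one_add hew hw]
  have hNi : (N : R) * (N⁻¹ : Rˣ) = 1 := N.mul_inv
  set i : R := ((N⁻¹ : Rˣ) : R)
  have hbase : (x : R) * (1 + u2 * w) + c = s * (1 + n * i * u2 * w) := by
    linear_combination hs + i * u2 * w * hx - x * u2 * w * hNi
  have hmul : (k : R) * ((x * (1 + u2 * w) + c) ^ m - a * (y * (1 + ((-u1 : ℤ) : R) * w))) =
      (s ^ m * t : Rˣ) * w := by
    rw [hbase, mul_pow, one_add_pow_of_mul_self_eq_zero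
      (by linear_combination (n * i * u2 : R) ^ 2 * hw)]
    push_cast
    linear_combination (-k * (1 - u1 * w) : R) * hy + (s : R) ^ m * w * hu
      + (s : R) ^ m * n * u2 * w * hNi - (s : R) ^ m * n * u2 * w * i * hN
  have hkunit : IsUnit (k : R) := isUnit_of_mul_isUnit_left (hN ▸ N.isUnit)
  rw [← hkunit.mul_right_eq_zero, hmul, Units.mul_right_eq_zero]

theorem ZMod.isUnit_intCast_prime_pow {p : ℕ} (hp : p.Prime) (r : ℕ) {z : ℤ}
    (hz : ¬ (p : ℤ) ∣ z) : IsUnit (z : ZMod (p ^ r)) := by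
  rw [ZMod.coe_int_isUnit_iff_isCoprime]
  push_cast
  exact ((Nat.prime_iff_prime_int.mp hp).coprime_iff_not_dvd.mpr hz).pow_left

/-- With `𝒞, ℰ` as before, `p ∣ 𝒞 - ℰ`, `p ∤ ackm(km-n)`, and
`α ≡ α₁^(u₁) α₂^(u₂) (mod p²)`, one has
`(α^(k₁) + c)^m - a α^(n₁) ≡ 0 (mod p²)  ↔  α₁^(n₁) ≡ α₂^(k₁) (mod p²)`. -/
theorem statement_9 (a c : ℤ) (hc : c ≠ 0) (k m n : ℕ) (hn : 1 ≤ n) (hlt : n < k * m)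
    (t n1 k1 : ℕ) (ht : t = Nat.gcd n k) (hn1 : n = n1 * t) (hk1 : k = k1 * t)
    (u1 u2 : ℤ) (hu : (k : ℤ) * u1 + (n : ℤ) * u2 = (t : ℤ))
    (p : ℕ) (hp : p.Prime)
    (hdvd : (p : ℤ) ∣
      (((k * m : ℕ) : ℤ) ^ (k1 * m) * c ^ (k1 * m - n1) -
        a ^ k1 * (n : ℤ) ^ n1 * (((k * m : ℕ) : ℤ) - (n : ℤ)) ^ (k1 * m - n1)))
    (hnd : ¬ (p : ℤ) ∣ a * c * (k : ℤ) * (m : ℤ) * (((k * m : ℕ) : ℤ) - (n : ℤ)))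
    (α1 α2 : ℤ)
    (hα1 : α1 * (((k * m : ℕ) : ℤ) - (n : ℤ)) ≡ (n : ℤ) * c [ZMOD (p : ℤ) ^ 2])
    (hα2 : a * α2 * (((k * m : ℕ) : ℤ) - (n : ℤ)) ^ m ≡
      (((k * m : ℕ) : ℤ) * c) ^ m [ZMOD (p : ℤ) ^ 2])
    (α : ℤ)
    (hα : (α : ZMod (p ^ 2)) =
      zpowR ((α1 : ZMod (p ^ 2))) u1 * zpowR ((α2 : ZMod (p ^ 2))) u2) :
    ((α ^ k1 + c) ^ m - a * α ^ n1 ≡ 0 [ZMOD (p : ℤ) ^ 2]) ↔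
      (α1 ^ n1 ≡ α2 ^ k1 [ZMOD (p : ℤ) ^ 2]) := by
  have hpZ : Prime (p : ℤ) := Nat.prime_iff_prime_int.mp hp
  have htpos : 0 < t := by
    rw [ht]
    exact Nat.gcd_pos_of_pos_left _ hn
  have hn1pos : n1 ≠ 0 := by
    rintro rfl
    omega
  have hle : n1 ≤ k1 * m := by
    refine le_of_lt (lt_of_mul_lt_mul_right (a := t) ?_ (Nat.zero_le t))
    calc n1 * t = n := hn1.symm
      _ < k * m := hlt
      _ = k1 * m * t := by
        rw [hk1]
        ring
  obtain ⟨⟨⟨⟨hpa, hpc⟩, hpk⟩, hpm⟩, hpd⟩ :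
      (((¬ (p : ℤ) ∣ a ∧ ¬ (p : ℤ) ∣ c) ∧ ¬ (p : ℤ) ∣ k) ∧ ¬ (p : ℤ) ∣ m) ∧
        ¬ (p : ℤ) ∣ ((k * m : ℕ) : ℤ) - n := by
    simpa only [hpZ.dvd_mul, not_or] using hnd
  have hpN : ¬ (p : ℤ) ∣ ((k * m : ℕ) : ℤ) := by
    push_cast
    exact fun h => (hpZ.dvd_or_dvd h).elim hpk hpm
  have hpn : ¬ (p : ℤ) ∣ (n : ℤ) := by
    intro h
    have hE : (p : ℤ) ∣ a ^ k1 * (n : ℤ) ^ n1 * (((k * m : ℕ) : ℤ) - n) ^ (k1 * m - n1) :=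
      ((h.trans (dvd_pow_self _ hn1pos)).mul_left _).mul_right _
    have hC := (dvd_sub_left hE).mp hdvd
    exact (hpZ.dvd_or_dvd hC).elim (fun h => hpN (hpZ.dvd_of_dvd_pow h))
      fun h => hpc (hpZ.dvd_of_dvd_pow h)
  have hpt : ¬ (p : ℤ) ∣ (t : ℤ) := by
    intro h
    apply hpk
    rw [hk1]
    push_cast
    exact h.mul_left _
  have hu1 : (k1 : ℤ) * u1 + (n1 : ℤ) * u2 = 1 := by
    have h0 : (t : ℤ) ≠ 0 := by exact_mod_cast htpos.ne'
    apply mul_right_cancel₀ h0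
    rw [hk1, hn1] at hu
    push_cast at hu
    linear_combination hu
  have hmod (z w : ℤ) : z ≡ w [ZMOD (p : ℤ) ^ 2] ↔ (z : ZMod (p ^ 2)) = w := by
    rw [ZMod.intCast_eq_intCast_iff]
    push_cast
    rfl
  obtain ⟨ua, hua⟩ := ZMod.isUnit_intCast_prime_pow hp 2 hpa
  obtain ⟨uc, huc⟩ := ZMod.isUnit_intCast_prime_pow hp 2 hpc
  obtain ⟨un, hun⟩ := ZMod.isUnit_intCast_prime_pow hp 2 hpn
  obtain ⟨uN, huN⟩ := ZMod.isUnit_intCast_prime_pow hp 2 hpN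
  obtain ⟨ud, hud⟩ := ZMod.isUnit_intCast_prime_pow hp 2 hpd
  obtain ⟨ut, hut⟩ := ZMod.isUnit_intCast_prime_pow hp 2 hpt
  have hpp : (p : ZMod (p ^ 2)) * p = 0 := by
    rw [← sq]
    exact_mod_cast ZMod.natCast_self (p ^ 2)
  obtain ⟨q, hq⟩ := hdvd
  apply_fun (Int.cast : ℤ → ZMod (p ^ 2)) at hq hu
  rw [hmod] at hα1 hα2
  rw [hmod, hmod]
  push_cast at hα1 hα2 hq hu huN hud hun hut ⊢
  rw [← huN, ← hun] at hud
  rw [← huN, ← hun] at hα1 hα2 hq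
  rw [← hud] at hα1 hα2 hq
  rw [← huc] at hα1 hα2 hq ⊢
  rw [← hua] at hα2 hq ⊢
  rw [← hut] at hu
  obtain ⟨x, hx⟩ : IsUnit (α1 : ZMod (p ^ 2)) :=
    isUnit_of_mul_isUnit_left (y := (ud : ZMod (p ^ 2)))
      (by rw [hα1]; exact (un * uc).isUnit)
  obtain ⟨y, hy⟩ : IsUnit (α2 : ZMod (p ^ 2)) := by
    refine isUnit_of_mul_isUnit_right (x := (ua : ZMod (p ^ 2)))
      (isUnit_of_mul_isUnit_left (y := (ud : ZMod (p ^ 2)) ^ m) ?_)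
    rw [hα2]
    exact ((uN * uc) ^ m).isUnit
  rw [← hx, ← hy] at hα ⊢
  rw [← hx] at hα1
  rw [← hy] at hα2
  rw [zpowR_coe_units, zpowR_coe_units, ← Units.val_mul] at hα
  rw [hα]
  obtain ⟨s, hs⟩ : ∃ s, s * ud = uN * uc := ⟨uN * uc * ud⁻¹, by group⟩
  have hsd : (s : ZMod (p ^ 2)) * ud = uN * uc := by exact_mod_cast congrArg Units.val hs
  have hxs : (x : ZMod (p ^ 2)) + uc = s := by
    rw [← Units.mul_left_inj ud]
    linear_combination hα1 - hsd + uc * hud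
  have hxN : (x : ZMod (p ^ 2)) * uN = s * n := by
    rw [← Units.mul_left_inj ud]
    linear_combination uN * hα1 - un * hsd + s * ud * hun
  have hys : (ua : ZMod (p ^ 2)) * y = s ^ m := by
    rw [← Units.mul_left_inj (ud ^ m), Units.val_pow_eq_pow_val, hα2, ← mul_pow, hsd]
  obtain ⟨e, he⟩ : ∃ e, y ^ k1 = x ^ n1 * e := ⟨(x ^ n1)⁻¹ * y ^ k1, by group⟩
  have hyx : (y : ZMod (p ^ 2)) ^ k1 = x ^ n1 * (1 + (e - 1)) := by
    rw [add_sub_cancel]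
    exact_mod_cast congrArg Units.val he
  have hdiff : ((x ^ n1 * ua ^ k1 * ud ^ (k1 * m) : (ZMod (p ^ 2))ˣ) : ZMod (p ^ 2)) * (e - 1) =
      (uc : ZMod (p ^ 2)) ^ n1 * (p * q) := by
    obtain ⟨l, hl⟩ := Nat.exists_eq_add_of_le hle
    have h2 := congrArg (· ^ k1) hα2
    have h1 := congrArg (· ^ n1) hα1
    simp only [mul_pow, ← pow_mul, mul_comm m k1] at h1 h2
    rw [hl, Nat.add_sub_cancel_left] at hq
    rw [hl] at h2 ⊢
    push_cast
    simp only [pow_add] at h2 hq ⊢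
    linear_combination h2 - (ua : ZMod (p ^ 2)) ^ k1 * ud ^ l * h1
      + (uc : ZMod (p ^ 2)) ^ n1 * hq - (ua : ZMod (p ^ 2)) ^ k1 * ud ^ n1 * ud ^ l * hyx
  have hw : ((e : ZMod (p ^ 2)) - 1) * (e - 1) = 0 := by
    rw [← Units.mul_right_eq_zero (x ^ n1 * ua ^ k1 * ud ^ (k1 * m)), ← mul_assoc, hdiff,
      ← Units.mul_right_eq_zero (x ^ n1 * ua ^ k1 * ud ^ (k1 * m)), mul_left_comm, hdiff]
    linear_combination (uc : ZMod (p ^ 2)) ^ n1 * q * (uc : ZMod (p ^ 2)) ^ n1 * q * hpp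
  rw [trinomial_eq_zero_iff hu1 hu huN hxs hxN hys hw hyx, hyx,
    ← Units.mul_right_eq_zero (x ^ n1), Units.val_pow_eq_pow_val, mul_one_add,
    left_eq_add]
end

section
/- Let q be a prime and let a be an integer with q ∣ a and q² ∤ a, let m ≥ 2, j ≥ 1 and n ≥ 1 be integers with q^j m > n. Then the polynomial f(x) = (x^{q^j} + 1)^m − a x^n is irreducible over ℚ, and likewise f(x) = (x^{q^j} − 1)^m − a x^n is irreducible over ℚ. -/
open Polynomial

/-- The Eisenstein criterion over `ℤ` at a prime `q`, after a shift of the variable by `c`. -/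
theorem Polynomial.Monic.irreducible_of_map_zmod_eq_X_sub_C_pow {q : ℕ} [Fact q.Prime]
    {f : ℤ[X]} (hf : f.Monic) (hd : 0 < f.natDegree) (c : ℤ) (N : ℕ)
    (hmod : f.map (algebraMap ℤ (ZMod q)) = (X - C (c : ZMod q)) ^ N)
    (hc : ¬ (q : ℤ) ^ 2 ∣ f.eval c) : Irreducible f := by
  have hmap : (X - C c : ℤ[X]).map (algebraMap ℤ (ZMod q)) = X - C (c : ZMod q) := by simp
  refine generalizedEisenstein (K := ZMod q) (q := X - C c) (p := N) ?_ (monic_X_sub_C c)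
    hf.isPrimitive hd ?_ ?_ ?_
  · rw [hmap]
    exact irreducible_X_sub_C _
  · simp [hf.leadingCoeff]
  · rw [hmap, hmod, hf.leadingCoeff]
    simp
  · rw [modByMonic_X_sub_C_eq_C_eval, map_C, Ne, C_eq_zero, Ideal.Quotient.eq_zero_iff_mem,
      algebraMap_int_eq, ZMod.ker_intCastRingHom, Ideal.span_singleton_pow,
      Ideal.mem_span_singleton]
    exact hc

theorem irreducible_X_pow_sub_C_pow_sub_C_mul_X_pow {q : ℕ} (hq : q.Prime) {a c : ℤ}
    (hqa : (q : ℤ) ∣ a) (hq2a : ¬ (q : ℤ) ^ 2 ∣ a) (hc : IsUnit c)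
    {m j n : ℕ} (hm : 2 ≤ m) (hlt : n < q ^ j * m) :
    Irreducible (((X ^ q ^ j - C c) ^ m - C a * X ^ n : ℤ[X]).map (Int.castRingHom ℚ)) := by
  have : Fact q.Prime := ⟨hq⟩
  have hQ : q ^ j ≠ 0 := pow_ne_zero _ hq.ne_zero
  have hmonic : ((X ^ q ^ j - C c : ℤ[X]) ^ m).Monic := (monic_X_pow_sub_C c hQ).pow m
  have hdeg : ((X ^ q ^ j - C c : ℤ[X]) ^ m).natDegree = q ^ j * m := by
    rw [(monic_X_pow_sub_C c hQ).natDegree_pow, natDegree_X_pow_sub_C, mul_comm]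
  have hlow : (C a * X ^ n : ℤ[X]).degree < ((X ^ q ^ j - C c : ℤ[X]) ^ m).degree := by
    rw [degree_eq_natDegree hmonic.ne_zero, hdeg]
    exact (degree_C_mul_X_pow_le n a).trans_lt (by exact_mod_cast hlt)
  have hf : ((X ^ q ^ j - C c) ^ m - C a * X ^ n : ℤ[X]).Monic := hmonic.sub_of_left hlow
  rw [← IsPrimitive.Int.irreducible_iff_irreducible_map_cast hf.isPrimitive]
  have haq : (a : ZMod q) = 0 := (ZMod.intCast_zmod_eq_zero_iff_dvd a q).mpr hqa
  refine hf.irreducible_of_map_zmod_eq_X_sub_C_pow (q := q) ?_ c (q ^ j * m) ?_ ?_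
  · rw [natDegree_eq_of_degree_eq (degree_sub_eq_left_of_degree_lt hlow), hdeg]
    omega
  · have h : (X ^ q ^ j - C (c : ZMod q)) = (X - C (c : ZMod q)) ^ q ^ j := by
      rw [sub_pow_char_pow, ← C_pow, ZMod.pow_card_pow]
    rw [pow_mul, ← h, Polynomial.map_sub, Polynomial.map_pow, Polynomial.map_sub,
      Polynomial.map_mul, map_C, map_C, Polynomial.map_pow, map_X, algebraMap_int_eq,
      eq_intCast, eq_intCast, haq, C_0, zero_mul, sub_zero]
  · have hdvd : (q : ℤ) ∣ c ^ q ^ j - c := by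
      rw [← ZMod.intCast_zmod_eq_zero_iff_dvd]
      simp [ZMod.pow_card_pow]
    have hsq : (q : ℤ) ^ 2 ∣ (c ^ q ^ j - c) ^ m :=
      (pow_dvd_pow_of_dvd hdvd 2).trans (pow_dvd_pow _ hm)
    simpa [dvd_sub_right hsq, (hc.pow n).dvd_mul_right] using hq2a

/-- If `q` is a prime with `q ∥ a`, `m ≥ 2`, `j ≥ 1`, `n ≥ 1` and
`q^j m > n`, then both `(x^(q^j) + 1)^m - a x^n` and `(x^(q^j) - 1)^m - a x^n` are
irreducible over `ℚ`. -/
theorem statement_13 (q : ℕ) (hq : q.Prime) (a : ℤ)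
    (hqa : (q : ℤ) ∣ a) (hq2a : ¬ ((q : ℤ) ^ 2 ∣ a))
    (m j n : ℕ) (hm : 2 ≤ m) (hj : 1 ≤ j) (hn : 1 ≤ n) (hlt : n < q ^ j * m) :
    Irreducible (((X ^ q ^ j + 1) ^ m - C a * X ^ n : Polynomial ℤ).map
      (Int.castRingHom ℚ)) ∧
    Irreducible (((X ^ q ^ j - 1) ^ m - C a * X ^ n : Polynomial ℤ).map
      (Int.castRingHom ℚ)) := by
  have h₁ := irreducible_X_pow_sub_C_pow_sub_C_mul_X_pow hq hqa hq2a
    (isUnit_one.neg : IsUnit (-1 : ℤ)) hm hlt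
  have h₂ := irreducible_X_pow_sub_C_pow_sub_C_mul_X_pow hq hqa hq2a
    (isUnit_one : IsUnit (1 : ℤ)) hm hlt
  rw [C_neg, C_1, sub_neg_eq_add] at h₁
  rw [C_1] at h₂
  exact ⟨h₁, h₂⟩
end

section
/- Let k, m, n ∈ ℕ with km > n ≥ 1 and gcd(km, n) = 1, and define F(x) = n^n (km−n)^{km−n} x^k − (km)^{km} ∈ ℤ[x]. Then F has no repeated roots, and for every prime ℓ, F does not have a local obstruction at ℓ; that is, there exists z ∈ ℤ with gcd(z, ℓ) = 1 such that F(z) ≢ 0 (mod ℓ²). -/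
open Polynomial

theorem isCoprime_pow_mul_sub_pow {N n : ℤ} (h : IsCoprime N n) (a b c : ℕ) :
    IsCoprime (n ^ a * (N - n) ^ b) (N ^ c) := by
  have h' : IsCoprime (N - n) N := by
    obtain ⟨u, v, huv⟩ := h
    exact ⟨-v, u + v, by linear_combination huv⟩
  exact (h.symm.pow (m := a) (n := c)).mul_left (h'.pow (m := b) (n := c))

theorem aeval_derivative_ne_zero_of_binomial {A B : ℤ} {k : ℕ} (hA : A ≠ 0) (hB : B ≠ 0)
    (hk : k ≠ 0) {z : ℂ} (hz : aeval z (C A * X ^ k - C B) = 0) :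
    aeval z (derivative (C A * X ^ k - C B)) ≠ 0 := by
  intro hd
  simp only [map_sub, map_mul, map_pow, aeval_X, eq_intCast] at hz
  simp [derivative_X_pow, hA, hk] at hd
  rw [hd.1, zero_pow hk] at hz
  simp [hB] at hz

/-- If `A` and `B` are coprime and every prime dividing `k` divides `B`, then one of `1`, `1 + ℓ`
witnesses that `A * X ^ k - B` has no local obstruction at `ℓ`. -/
theorem exists_not_sq_dvd_of_isCoprime {A B : ℤ} {k ℓ : ℕ} (hAB : IsCoprime A B)
    (hℓ : ℓ.Prime) (hk : ℓ ∣ k → (ℓ : ℤ) ∣ B) :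
    ∃ z : ℤ, Int.gcd z (ℓ : ℤ) = 1 ∧ ¬ ((ℓ : ℤ) ^ 2 ∣ A * z ^ k - B) := by
  have hp : Prime (ℓ : ℤ) := Nat.prime_iff_prime_int.mp hℓ
  by_contra! h
  have h1 : (ℓ : ℤ) ^ 2 ∣ A - B := by simpa using h 1 (by simp)
  have h2 := h (1 + ℓ) (by simp)
  have hAB_dvd : (ℓ : ℤ) ∣ A - B := (dvd_pow_self _ two_ne_zero).trans h1
  have hA : ¬ (ℓ : ℤ) ∣ A := fun hd =>
    hp.not_isUnit (hAB.isUnit_of_dvd' hd ((dvd_sub_right hd).mp hAB_dvd))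
  obtain ⟨c, hc⟩ := powAddExpansion (1 : ℤ) (ℓ : ℤ) k
  have h3 : (ℓ : ℤ) * ℓ ∣ ℓ * (A * k) := by
    have h4 := dvd_sub (dvd_sub h2 h1) (Dvd.intro (A * c) rfl)
    rw [hc, one_pow, one_pow] at h4
    rw [← sq]
    have h6 : (ℓ : ℤ) * (A * k) =
        A * (1 + k * 1 * ℓ + c * ℓ ^ 2) - B - (A - B) - ℓ ^ 2 * (A * c) := by
      ring
    exact h6 ▸ h4
  have h5 : (ℓ : ℤ) ∣ k :=
    (hp.dvd_or_dvd ((mul_dvd_mul_iff_left hp.ne_zero).mp h3)).resolve_left hA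
  exact hA ((dvd_iff_dvd_of_dvd_sub hAB_dvd).mpr (hk (by exact_mod_cast h5)))

/-- For `km > n ≥ 1` with `gcd(km, n) = 1`, the polynomial
`F(x) = n^n (km-n)^(km-n) x^k - (km)^(km)` has no repeated roots, and has no local
obstruction at any prime `ℓ`: there is `z` coprime to `ℓ` with `F(z) ≢ 0 (mod ℓ²)`. -/
theorem statement_16 (k m n : ℕ) (hn : 1 ≤ n) (hlt : n < k * m)
    (hgcd : Nat.gcd (k * m) n = 1)
    (F : Polynomial ℤ)
    (hF : F = Polynomial.C ((n : ℤ) ^ n * (((k * m : ℕ) : ℤ) - (n : ℤ)) ^ (k * m - n)) *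
        Polynomial.X ^ k - Polynomial.C (((k * m : ℕ) : ℤ) ^ (k * m))) :
    (∀ z : ℂ, Polynomial.aeval z F = 0 → Polynomial.aeval z (Polynomial.derivative F) ≠ 0) ∧
    (∀ ℓ : ℕ, ℓ.Prime → ∃ z : ℤ, Int.gcd z (ℓ : ℤ) = 1 ∧ ¬ ((ℓ : ℤ) ^ 2 ∣ F.eval z)) := by
  have hN : k * m ≠ 0 := by omega
  subst hF
  refine ⟨fun z hz => aeval_derivative_ne_zero_of_binomial ?_ ?_ (left_ne_zero_of_mul hN) hz,
    fun ℓ hℓ => ?_⟩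
  · exact mul_ne_zero (pow_ne_zero _ (by omega)) (pow_ne_zero _ (by omega))
  · exact pow_ne_zero _ (by exact_mod_cast hN)
  · simp only [eval_sub, eval_mul, eval_pow, eval_X, eval_C]
    refine exists_not_sq_dvd_of_isCoprime
      (isCoprime_pow_mul_sub_pow (Nat.isCoprime_iff_coprime.mpr hgcd) _ _ _) hℓ fun hk => ?_
    exact dvd_pow (Int.natCast_dvd_natCast.mpr (hk.mul_right m)) hN
end
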